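/- In the symmetric group on 16 points {1,…,16}, let a = (1,3,15,13)(2,11,16,5)(4,7,14,9)(6,10,12,8), b = (1,12,15,6)(2,9,16,7)(3,10,13,8)(4,11,14,5), c = (1,8,15,10)(2,5,16,11)(3,6,13,12)(4,7,14,9), d = (1,13,15,3)(2,9,16,7)(4,5,14,11)(6,10,12,8). Then the subgroup generated by a, b, c, d has order 32; the subgroup generated by a, b is isomorphic to the quaternion group Q₈, the subgroup generated by c, d is isomorphic to Q₈, and each of a, b commutes with each of c, d. -/

import Mathlib

/-- The permutation `(1,3,15,13)(2,11,16,5)(4,7,14,9)(6,10,12,8)` on `{1,…,16}`,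
written on `Fin 16 = {0,…,15}` by subtracting 1 from each point. -/
def permA : Equiv.Perm (Fin 16) :=
  ([0,2,14,12] : List (Fin 16)).formPerm * ([1,10,15,4] : List (Fin 16)).formPerm *
    ([3,6,13,8] : List (Fin 16)).formPerm * ([5,9,11,7] : List (Fin 16)).formPerm

/-- `(1,12,15,6)(2,9,16,7)(3,10,13,8)(4,11,14,5)` on `{1,…,16}`, shifted to `Fin 16`. -/
def permB : Equiv.Perm (Fin 16) :=
  ([0,11,14,5] : List (Fin 16)).formPerm * ([1,8,15,6] : List (Fin 16)).formPerm *
    ([2,9,12,7] : List (Fin 16)).formPerm * ([3,10,13,4] : List (Fin 16)).formPerm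

/-- `(1,8,15,10)(2,5,16,11)(3,6,13,12)(4,7,14,9)` on `{1,…,16}`, shifted to `Fin 16`. -/
def permC : Equiv.Perm (Fin 16) :=
  ([0,7,14,9] : List (Fin 16)).formPerm * ([1,4,15,10] : List (Fin 16)).formPerm *
    ([2,5,12,11] : List (Fin 16)).formPerm * ([3,6,13,8] : List (Fin 16)).formPerm

/-- `(1,13,15,3)(2,9,16,7)(4,5,14,11)(6,10,12,8)` on `{1,…,16}`, shifted to `Fin 16`. -/
def permD : Equiv.Perm (Fin 16) :=
  ([0,12,14,2] : List (Fin 16)).formPerm * ([1,8,15,6] : List (Fin 16)).formPerm *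
    ([3,4,13,10] : List (Fin 16)).formPerm * ([5,9,11,7] : List (Fin 16)).formPerm

namespace QuaternionGroup

section Lift

variable {G : Type*} [Group G] {x y : G}

theorem pow_val_add_of_pow_four_eq_one (h : x ^ 4 = 1) (i j : ZMod (2 * 2)) :
    x ^ (i + j).val = x ^ i.val * x ^ j.val := by
  rw [ZMod.val_add, ← pow_add]
  exact (pow_eq_pow_mod _ h).symm

theorem pow_val_sub_of_pow_four_eq_one (h : x ^ 4 = 1) (i j : ZMod (2 * 2)) :
    x ^ (j - i).val = (x ^ i.val)⁻¹ * x ^ j.val := by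
  rw [eq_inv_mul_iff_mul_eq, ← pow_val_add_of_pow_four_eq_one h, add_sub_cancel]

theorem pow_mul_eq_mul_inv_pow (hxy : x * y * x = y) (k : ℕ) :
    x ^ k * y = y * (x ^ k)⁻¹ := by
  have h : SemiconjBy y x⁻¹ x := by
    rw [SemiconjBy, mul_inv_eq_iff_eq_mul, hxy]
  simpa using (h.pow_right k).eq.symm

/-- The homomorphism out of the quaternion group of order 8 determined by elements
`x`, `y` with `x ^ 4 = 1`, `y ^ 2 = x ^ 2` and `x * y * x = y`. -/
def lift (x y : G) (hx : x ^ 4 = 1) (hy : y ^ 2 = x ^ 2) (hxy : x * y * x = y) :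
    QuaternionGroup 2 →* G :=
  MonoidHom.mk' (fun g ↦ match g with
    | a i => x ^ i.val
    | xa i => y * x ^ i.val) <| by
    rintro (i | i) (j | j)
    · exact pow_val_add_of_pow_four_eq_one hx i j
    · change y * x ^ (j - i).val = x ^ i.val * (y * x ^ j.val)
      rw [pow_val_sub_of_pow_four_eq_one hx, ← mul_assoc (x ^ i.val),
        pow_mul_eq_mul_inv_pow hxy, mul_assoc]
    · change y * x ^ (i + j).val = y * x ^ i.val * x ^ j.val
      rw [pow_val_add_of_pow_four_eq_one hx, mul_assoc]
    · change x ^ (2 + j - i).val = y * x ^ i.val * (y * x ^ j.val)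
      have h2 : x ^ (2 : ZMod (2 * 2)).val = y ^ 2 := hy.symm
      rw [add_sub_assoc, pow_val_add_of_pow_four_eq_one hx, h2,
        pow_val_sub_of_pow_four_eq_one hx, mul_assoc y, ← mul_assoc (x ^ i.val),
        pow_mul_eq_mul_inv_pow hxy, sq]
      simp only [mul_assoc]

variable (hx : x ^ 4 = 1) (hy : y ^ 2 = x ^ 2) (hxy : x * y * x = y)

theorem lift_a (i : ZMod (2 * 2)) : lift x y hx hy hxy (a i) = x ^ i.val := rfl

theorem lift_xa (i : ZMod (2 * 2)) : lift x y hx hy hxy (xa i) = y * x ^ i.val := rfl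

theorem range_lift : (lift x y hx hy hxy).range = Subgroup.closure {x, y} := by
  apply le_antisymm
  · have hxm : x ∈ Subgroup.closure {x, y} := Subgroup.subset_closure (by simp)
    have hym : y ∈ Subgroup.closure {x, y} := Subgroup.subset_closure (by simp)
    rintro _ ⟨i | i, rfl⟩
    · exact pow_mem hxm _
    · exact mul_mem hym (pow_mem hxm _)
  · rw [Subgroup.closure_le]
    rintro _ (rfl | rfl)
    · exact ⟨a 1, pow_one _⟩
    · exact ⟨xa 0, by simp [lift_xa]⟩

theorem lift_injective (hx2 : x ^ 2 ≠ 1) : Function.Injective (lift x y hx hy hxy) := by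
  have hord : orderOf x = 4 := orderOf_eq_prime_pow (p := 2) (n := 1) (by simpa using hx2) hx
  rw [injective_iff_map_eq_one]
  rintro (i | i) hi
  · rw [lift_a, ← orderOf_dvd_iff_pow_eq_one, hord] at hi
    have : i.val = 0 := Nat.eq_zero_of_dvd_of_lt hi (ZMod.val_lt i)
    rw [(ZMod.val_eq_zero i).1 this, a_zero]
  · rw [lift_xa, mul_eq_one_iff_eq_inv] at hi
    have hc : Commute x y := hi ▸ ((Commute.refl x).pow_right _).inv_right
    refine absurd ?_ hx2
    rwa [hc.eq, mul_assoc, mul_eq_left, ← sq] at hxy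

theorem nonempty_closure_mulEquiv (hx : x ^ 4 = 1) (hy : y ^ 2 = x ^ 2)
    (hxy : x * y * x = y) (hx2 : x ^ 2 ≠ 1) :
    Nonempty ((Subgroup.closure {x, y} : Subgroup G) ≃* QuaternionGroup 2) :=
  ⟨((MonoidHom.ofInjective (lift_injective hx hy hxy hx2)).trans
    (MulEquiv.subgroupCongr (range_lift hx hy hxy))).symm⟩

end Lift

end QuaternionGroup

open QuaternionGroup

theorem permA_pow_four : permA ^ 4 = 1 := by decide +kernel

theorem permB_sq : permB ^ 2 = permA ^ 2 := by decide +kernel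

theorem permA_mul_permB_mul_permA : permA * permB * permA = permB := by decide +kernel

theorem permC_pow_four : permC ^ 4 = 1 := by decide +kernel

theorem permD_sq : permD ^ 2 = permC ^ 2 := by decide +kernel

theorem permC_mul_permD_mul_permC : permC * permD * permC = permD := by decide +kernel

theorem permA_commute_permC : Commute permA permC := by
  unfold Commute SemiconjBy; decide +kernel

theorem permA_commute_permD : Commute permA permD := by
  unfold Commute SemiconjBy; decide +kernel

theorem permB_commute_permC : Commute permB permC := by
  unfold Commute SemiconjBy; decide +kernel

theorem permB_commute_permD : Commute permB permD := by
  unfold Commute SemiconjBy; decide +kernel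

/-- The embedding of the quaternion group with image generated by `permA` and `permB`. -/
def quaternionHomAB : QuaternionGroup 2 →* Equiv.Perm (Fin 16) :=
  lift permA permB permA_pow_four permB_sq permA_mul_permB_mul_permA

/-- The embedding of the quaternion group with image generated by `permC` and `permD`. -/
def quaternionHomCD : QuaternionGroup 2 →* Equiv.Perm (Fin 16) :=
  lift permC permD permC_pow_four permD_sq permC_mul_permD_mul_permC

theorem quaternionHomAB_commute_quaternionHomCD (p q : QuaternionGroup 2) :
    Commute (quaternionHomAB p) (quaternionHomCD q) := by
  have hA : Commute permA (quaternionHomCD q) := by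
    rcases q with j | j
    · exact permA_commute_permC.pow_right _
    · exact permA_commute_permD.mul_right (permA_commute_permC.pow_right _)
  have hB : Commute permB (quaternionHomCD q) := by
    rcases q with j | j
    · exact permB_commute_permC.pow_right _
    · exact permB_commute_permD.mul_right (permB_commute_permC.pow_right _)
  rcases p with i | i
  · exact hA.pow_left _
  · exact hB.mul_left (hA.pow_left _)

/-- The homomorphism from `Q₈ × Q₈` whose image is the central product generated by
`permA`, `permB`, `permC` and `permD`. -/
def quaternionProdHom : QuaternionGroup 2 × QuaternionGroup 2 →* Equiv.Perm (Fin 16) :=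
  quaternionHomAB.noncommCoprod quaternionHomCD quaternionHomAB_commute_quaternionHomCD

theorem range_quaternionProdHom :
    quaternionProdHom.range = Subgroup.closure {permA, permB, permC, permD} := by
  rw [quaternionProdHom, MonoidHom.noncommCoprod_range, quaternionHomAB, quaternionHomCD,
    range_lift, range_lift, ← Subgroup.closure_union, Set.insert_union, Set.singleton_union]

theorem mem_ker_quaternionProdHom_iff (g : QuaternionGroup 2 × QuaternionGroup 2) :
    g ∈ quaternionProdHom.ker ↔ g = 1 ∨ g = (a 2, a 2) := by
  have h : ∀ p q : QuaternionGroup 2,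
      quaternionHomAB p * quaternionHomCD q = 1 ↔ (p, q) = 1 ∨ (p, q) = (a 2, a 2) := by
    decide +kernel
  exact h g.1 g.2

theorem card_ker_quaternionProdHom : Nat.card quaternionProdHom.ker = 2 := by
  have h : (quaternionProdHom.ker : Set (QuaternionGroup 2 × QuaternionGroup 2)) =
      {1, (a 2, a 2)} := Set.ext mem_ker_quaternionProdHom_iff
  rw [← SetLike.coe_sort_coe, Nat.card_coe_set_eq, h, Set.ncard_pair (by decide)]

theorem card_range_quaternionProdHom : Nat.card quaternionProdHom.range = 32 := by
  have h := quaternionProdHom.ker.card_mul_index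
  rw [Subgroup.index_ker, card_ker_quaternionProdHom, Nat.card_prod,
    Nat.card_eq_fintype_card (α := QuaternionGroup 2), QuaternionGroup.card] at h
  omega

theorem stmt_14 :
    Nat.card (Subgroup.closure {permA, permB, permC, permD} :
      Subgroup (Equiv.Perm (Fin 16))) = 32 ∧
    Nonempty ((Subgroup.closure {permA, permB} : Subgroup (Equiv.Perm (Fin 16))) ≃*
      QuaternionGroup 2) ∧
    Nonempty ((Subgroup.closure {permC, permD} : Subgroup (Equiv.Perm (Fin 16))) ≃*
      QuaternionGroup 2) ∧
    Commute permA permC ∧ Commute permA permD ∧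
    Commute permB permC ∧ Commute permB permD := by
  refine ⟨?_, ?_, ?_, permA_commute_permC, permA_commute_permD, permB_commute_permC,
    permB_commute_permD⟩
  · rw [← range_quaternionProdHom, card_range_quaternionProdHom]
  · exact nonempty_closure_mulEquiv permA_pow_four permB_sq permA_mul_permB_mul_permA
      (by decide +kernel)
  · exact nonempty_closure_mulEquiv permC_pow_four permD_sq permC_mul_permD_mul_permC
      (by decide +kernel)
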